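/- Let $\Omega = \begin{pmatrix} \tau & z \\ z & \tau \end{pmatrix} \in \widehat{\mathbb{H}}_2$ with $\mathrm{Im}\,(2\tau + z) \in \mathbb{Z}$ and $\mathrm{Im}\,(\tau + 2z) \in \mathbb{Z}$, and let $H_*((z_1,z_2),(w_1,w_2)) = 2z_1\overline{w}_1 + 2z_2\overline{w}_2 + z_1\overline{w}_2 + z_2\overline{w}_1$ on $\mathbb{C}^2$ with imaginary part $E_* = \mathrm{Im}\,H_*$. Then: (i) $H_*$ is a positive definite Hermitian form; (ii) $E_*(u,v) \in \mathbb{Z}$ for all $u,v \in L_\Omega$, so $H_*$ is a positive definite Riemann form for $A_\Omega = \mathbb{C}^2/L_\Omega$; (iii) the matrix $\mathbb{E}_* = (E_*(e_i,e_j))_{1\le i,j\le 4}$ satisfies $\det \mathbb{E}_* = 9\big((\mathrm{Im}\,\tau)^2 - (\mathrm{Im}\,z)^2\big)^2$, so that $\sqrt{\det \mathbb{E}_*} = 3\big((\mathrm{Im}\,\tau)^2 - (\mathrm{Im}\,z)^2\big)$. -/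

import Mathlib

open Complex

noncomputable section

/-- The lattice `L_Ω = ℤ(τ,z) + ℤ(z,τ) + ℤ(1,0) + ℤ(0,1)` in `ℂ²` attached to
`Ω = [[τ,z],[z,τ]] ∈ Ĥ₂`. -/
def latt (τ z : ℂ) : Set (ℂ × ℂ) :=
  {v | ∃ m n k l : ℤ,
    v = ((m : ℂ) * τ + (n : ℂ) * z + (k : ℂ), (m : ℂ) * z + (n : ℂ) * τ + (l : ℂ))}

/-- The ℤ-basis `e₁ = (τ,z)`, `e₂ = (z,τ)`, `e₃ = (1,0)`, `e₄ = (0,1)` of `L_Ω`. -/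
def lattBasis (τ z : ℂ) : Fin 4 → ℂ × ℂ :=
  ![(τ, z), (z, τ), ((1 : ℂ), (0 : ℂ)), ((0 : ℂ), (1 : ℂ))]

/-- The Hermitian form
`H_*((z₁,z₂),(w₁,w₂)) = 2z₁w̄₁ + 2z₂w̄₂ + z₁w̄₂ + z₂w̄₁`. -/
def HStar (v w : ℂ × ℂ) : ℂ :=
  2 * v.1 * (starRingEnd ℂ) w.1 + 2 * v.2 * (starRingEnd ℂ) w.2 +
    v.1 * (starRingEnd ℂ) w.2 + v.2 * (starRingEnd ℂ) w.1

/-- `E_* = Im H_*`. -/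
def EStar (v w : ℂ × ℂ) : ℝ := (HStar v w).im

theorem EStar_eq (v w : ℂ × ℂ) :
    EStar v w = 2 * (v.1.im * w.1.re - v.1.re * w.1.im) +
      2 * (v.2.im * w.2.re - v.2.re * w.2.im) +
      (v.1.im * w.2.re - v.1.re * w.2.im) + (v.2.im * w.1.re - v.2.re * w.1.im) := by
  simp [EStar, HStar]
  ring

theorem HStar_conj_symm (v w : ℂ × ℂ) : HStar w v = (starRingEnd ℂ) (HStar v w) := by
  simp only [HStar, map_add, map_mul, map_ofNat, conj_conj]
  ring

theorem HStar_self_re (v : ℂ × ℂ) :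
    (HStar v v).re = normSq v.1 + normSq v.2 + normSq (v.1 + v.2) := by
  simp [HStar, normSq_apply]
  ring

theorem HStar_self_re_pos (v : ℂ × ℂ) (hv : v ≠ 0) : 0 < (HStar v v).re := by
  rw [HStar_self_re]
  have h1 := normSq_nonneg v.1
  have h2 := normSq_nonneg v.2
  have h3 := normSq_nonneg (v.1 + v.2)
  by_cases h : v.1 = 0
  · have : 0 < normSq v.2 := normSq_pos.2 fun h' => hv (Prod.ext h h')
    linarith
  · have : 0 < normSq v.1 := normSq_pos.2 h
    linarith

theorem EStar_int_of_mem_latt {τ z : ℂ} {a b : ℤ} (ha : (2 * τ + z).im = (a : ℝ))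
    (hb : (τ + 2 * z).im = (b : ℝ)) {u v : ℂ × ℂ} (hu : u ∈ latt τ z) (hv : v ∈ latt τ z) :
    ∃ n : ℤ, EStar u v = (n : ℝ) := by
  obtain ⟨m, n, k, l, rfl⟩ := hu
  obtain ⟨m', n', k', l', rfl⟩ := hv
  refine ⟨a * (m * k' - k * m' + n * l' - l * n') +
    b * (m * l' - l * m' + n * k' - k * n'), ?_⟩
  push_cast
  rw [← ha, ← hb, EStar_eq]
  simp
  ring

theorem det_EStar_lattBasis (τ z : ℂ) :
    (Matrix.of fun i j => EStar (lattBasis τ z i) (lattBasis τ z j) :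
      Matrix (Fin 4) (Fin 4) ℝ).det = 9 * (τ.im ^ 2 - z.im ^ 2) ^ 2 := by
  have h : (Matrix.of fun i j => EStar (lattBasis τ z i) (lattBasis τ z j) :
      Matrix (Fin 4) (Fin 4) ℝ) =
      !![0, 0, 2 * τ.im + z.im, τ.im + 2 * z.im;
         0, 0, τ.im + 2 * z.im, 2 * τ.im + z.im;
         -(2 * τ.im + z.im), -(τ.im + 2 * z.im), 0, 0;
         -(τ.im + 2 * z.im), -(2 * τ.im + z.im), 0, 0] := by
    ext i j
    fin_cases i <;> fin_cases j <;> simp [EStar_eq, lattBasis] <;> ring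
  rw [h]
  simp [Matrix.det_succ_row_zero, Fin.sum_univ_succ, Fin.succAbove]
  ring

/-- for `Ω = [[τ,z],[z,τ]] ∈ Ĥ₂` with `Im(2τ+z), Im(τ+2z) ∈ ℤ`:
(i) `H_*` is a positive definite Hermitian form; (ii) `E_*` is integer valued
on `L_Ω × L_Ω`, so `H_*` is a positive definite Riemann form for `A_Ω`;
(iii) `det 𝔼_* = 9((Im τ)² - (Im z)²)²`, so `√(det 𝔼_*) = 3((Im τ)² - (Im z)²)`. -/
theorem statement18 (τ z : ℂ) (hΩ : |z.im| < τ.im)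
    (h1 : ∃ a : ℤ, (2 * τ + z).im = (a : ℝ))
    (h2 : ∃ b : ℤ, (τ + 2 * z).im = (b : ℝ)) :
    ((∀ v w : ℂ × ℂ, HStar w v = (starRingEnd ℂ) (HStar v w)) ∧
      (∀ v : ℂ × ℂ, v ≠ 0 → 0 < (HStar v v).re)) ∧
    (∀ u ∈ latt τ z, ∀ v ∈ latt τ z, ∃ n : ℤ, EStar u v = (n : ℝ)) ∧
    ((Matrix.of fun i j => EStar (lattBasis τ z i) (lattBasis τ z j) :
        Matrix (Fin 4) (Fin 4) ℝ).det = 9 * (τ.im ^ 2 - z.im ^ 2) ^ 2 ∧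
      Real.sqrt (Matrix.of fun i j => EStar (lattBasis τ z i) (lattBasis τ z j) :
          Matrix (Fin 4) (Fin 4) ℝ).det = 3 * (τ.im ^ 2 - z.im ^ 2)) := by
  obtain ⟨a, ha⟩ := h1
  obtain ⟨b, hb⟩ := h2
  have hpos : 0 ≤ τ.im ^ 2 - z.im ^ 2 := sub_nonneg.2 (sq_le_sq.2 (hΩ.le.trans (le_abs_self _)))
  refine ⟨⟨HStar_conj_symm, HStar_self_re_pos⟩,
    fun u hu v hv => EStar_int_of_mem_latt ha hb hu hv, det_EStar_lattBasis τ z, ?_⟩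
  rw [det_EStar_lattBasis, show 9 * (τ.im ^ 2 - z.im ^ 2) ^ 2 =
    (3 * (τ.im ^ 2 - z.im ^ 2)) ^ 2 by ring, Real.sqrt_sq (by positivity)]

end
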